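/- For every integer n ≥ 1, the images under the quotient map ℝ[s,t] → ℝ[s,t]/(f_{n+1}, f_{n+2}) of the monomials s^p · t^{k-2p}, taken over all integers k, p with 0 ≤ k ≤ 2n and 0 ≤ 2p ≤ min(k, 2n-k), form a basis of ℝ[s,t]/(f_{n+1}, f_{n+2}) as an ℝ-vector space. (These monomials correspond to Alesker's basis U_{k,p} of the unitary valuation algebra.) -/

import Mathlib

open MvPolynomial Finset

/-- The weighted-degree-`k` component of `log(1+s+t)` in `ℝ[s,t]`,
where `s = X 0` has degree 2 and `t = X 1` has degree 1. -/
noncomputable def f (k : ℕ) : MvPolynomial (Fin 2) ℝ :=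
  (-1 : ℝ) ^ (k + 1) •
    ∑ i ∈ Finset.range (k / 2 + 1),
      (((-1 : ℝ) ^ i / ((k : ℝ) - i)) * (Nat.choose (k - i) i)) •
        (X 0 ^ i * X 1 ^ (k - 2 * i))


/-- Power sums in terms of elementary symmetric polynomials `t = X 1`, `s = X 0`. -/
noncomputable def P : ℕ → MvPolynomial (Fin 2) ℝ
  | 0 => 2
  | 1 => X 1
  | (k + 2) => X 1 * P (k + 1) - X 0 * P k

/-- the coefficients -/
noncomputable def cf (k i : ℕ) : ℝ := (-1 : ℝ) ^ i * ((k : ℝ) / ((k : ℝ) - i) * (Nat.choose (k - i) i))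

lemma cf_zero_of_lt {k i : ℕ} (hk : 1 ≤ k) (h : k < 2 * i) : cf k i = 0 := by
  unfold cf
  rw [Nat.choose_eq_zero_of_lt (by omega)]
  simp

lemma cf_rec {k i : ℕ} (hk : 1 ≤ k) : cf (k + 2) (i + 1) = cf (k + 1) (i + 1) - cf k i := by
  rcases lt_or_ge i k with h | h
  · obtain ⟨m, rfl⟩ : ∃ m, k = i + m := ⟨k - i, by omega⟩
    have hm : 1 ≤ m := by omega
    unfold cf
    rw [show i + m + 2 - (i + 1) = m + 1 by omega, show i + m + 1 - (i + 1) = m by omega,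
      show i + m - i = m by omega]
    have h1 : ((m + 1).choose (i + 1) : ℝ) = m.choose i + m.choose (i + 1) := by
      rw [Nat.choose_succ_succ]; push_cast; ring
    have h2 : (m.choose (i + 1) : ℝ) * (i + 1) = m.choose i * (m - i) := by
      rcases le_or_gt i m with hi | hi
      · have := Nat.choose_succ_right_eq m i
        have h3 : ((m - i : ℕ) : ℝ) = m - i := by push_cast [hi]; ring
        rw [← h3]
        exact_mod_cast this
      · rw [Nat.choose_eq_zero_of_lt hi, Nat.choose_eq_zero_of_lt (by omega)]; simp
    rw [h1]
    have hm0 : (m : ℝ) ≠ 0 := by positivity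
    have hm1 : (m : ℝ) + 1 ≠ 0 := by positivity
    push_cast
    rw [show (i : ℝ) + m + 2 - (i + 1) = m + 1 by ring, show (i : ℝ) + m + 1 - (i + 1) = m by ring,
      show (i : ℝ) + m - i = m by ring, pow_succ]
    field_simp
    linear_combination h2
  · rw [cf_zero_of_lt (by omega) (by omega), cf_zero_of_lt (by omega) (by omega),
      cf_zero_of_lt (by omega) (by omega)]; simp

lemma P_eq (N : ℕ) : ∀ k, 1 ≤ k → k < 2 * N →
    P k = ∑ i ∈ Finset.range N, cf k i • (X 0 ^ i * X 1 ^ (k - 2 * i)) := by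
  intro k
  induction k using Nat.strong_induction_on generalizing N with
  | _ k ih =>
    intro hk hN
    obtain ⟨N, rfl⟩ : ∃ M, N = M + 1 := ⟨N - 1, by omega⟩
    match k, hk, hN, ih with
    | 1, _, _, _ =>
      rw [Finset.sum_range_succ', Finset.sum_eq_zero]
      · simp [P, cf]
      · intro i _
        rw [cf_zero_of_lt (by omega) (by omega), zero_smul]
    | 2, _, hN, _ =>
      obtain ⟨N, rfl⟩ : ∃ M, N = M + 1 := ⟨N - 1, by omega⟩
      rw [Finset.sum_range_succ', Finset.sum_range_succ', Finset.sum_eq_zero]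
      · have h1 : cf 2 1 = -2 := by norm_num [cf]
        have h0 : cf 2 0 = 1 := by norm_num [cf]
        simp only [zero_add, h1, h0, P, smul_eq_C_mul, map_neg, map_ofNat, map_one]
        ring
      · intro i _
        rw [cf_zero_of_lt (by omega) (by omega), zero_smul]
    | k + 3, _, hN, ih =>
      rw [P, ih (k + 2) (by omega) (N + 1) (by omega) (by omega),
        ih (k + 1) (by omega) N (by omega) (by omega),
        Finset.sum_range_succ', Finset.sum_range_succ' (fun i => cf (k + 3) i • _),
        mul_add, Finset.mul_sum, Finset.mul_sum, add_sub_right_comm, ← Finset.sum_sub_distrib]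
      congr 1
      · refine Finset.sum_congr rfl fun i _ => ?_
        rw [cf_rec (k := k + 1) (i := i) (by omega),
          show k + 3 - 2 * (i + 1) = k + 1 - 2 * i by omega, sub_smul]
        congr 1
        · rcases le_or_gt (2 * (i + 1)) (k + 2) with h | h
          · rw [show k + 1 - 2 * i = k + 2 - 2 * (i + 1) + 1 by omega, mul_smul_comm]
            congr 1
            ring
          · rw [cf_zero_of_lt (by omega) h]; simp
        · rw [mul_smul_comm]
          congr 1
          ring
      · have h0 : ∀ j : ℕ, cf (j + 1) 0 = 1 := by
          intro j
          have : ((j : ℝ) + 1) ≠ 0 := by positivity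
          simp [cf, this]
        rw [h0, h0, one_smul, one_smul]
        simp only [mul_zero, Nat.sub_zero]
        ring

lemma f_eq (k : ℕ) (hk : 1 ≤ k) : f k = ((-1 : ℝ) ^ (k + 1) / k) • P k := by
  rw [P_eq (k / 2 + 1) k hk (by omega), f, div_eq_mul_inv, mul_smul]
  congr 1
  rw [Finset.smul_sum]
  refine Finset.sum_congr rfl fun i hi => ?_
  rw [smul_smul]
  congr 1
  unfold cf
  have : (k : ℝ) ≠ 0 := by positivity
  field_simp

lemma span_eq (n : ℕ) : (Ideal.span {f (n + 1), f (n + 2)} : Ideal (MvPolynomial (Fin 2) ℝ))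
    = Ideal.span {P (n + 1), P (n + 2)} := by
  have key : ∀ k, 1 ≤ k → ∃ u : (MvPolynomial (Fin 2) ℝ), IsUnit u ∧ f k = u * P k := by
    intro k hk
    refine ⟨C ((-1 : ℝ) ^ (k + 1) / k), ?_, ?_⟩
    · refine IsUnit.map C (isUnit_iff_ne_zero.2 ?_)
      have : (k : ℝ) ≠ 0 := by positivity
      positivity
    · rw [f_eq k hk, smul_eq_C_mul]
  obtain ⟨u, hu, h1⟩ := key (n + 1) (by omega)
  obtain ⟨v, hv, h2⟩ := key (n + 2) (by omega)
  rw [Ideal.span_insert, Ideal.span_insert, h1, h2, Ideal.span_singleton_mul_left_unit hu,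
    Ideal.span_singleton_mul_left_unit hv]

/-! Spanning -/

lemma P_mem (n : ℕ) : ∀ k, n + 1 ≤ k → P k ∈ Ideal.span {P (n + 1), P (n + 2)} := by
  intro k
  induction k using Nat.strong_induction_on with
  | _ k ih =>
    intro hk
    rcases Nat.lt_or_ge (n + 2) k with h | h
    · obtain ⟨j, rfl⟩ : ∃ j, k = j + 2 := ⟨k - 2, by omega⟩
      rw [P]
      exact sub_mem (Ideal.mul_mem_left _ _ (ih _ (by omega) (by omega)))
        (Ideal.mul_mem_left _ _ (ih _ (by omega) (by omega)))
    · rcases (show k = n + 1 ∨ k = n + 2 by omega) with rfl | rfl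
      · exact Ideal.subset_span (by simp)
      · exact Ideal.subset_span (by simp)

lemma sP_mem (n : ℕ) : ∀ a m, n + 1 ≤ a + m → X 0 ^ a * P m ∈ Ideal.span {P (n + 1), P (n + 2)} := by
  intro a
  induction a with
  | zero => intro m hm; simpa using P_mem n m (by omega)
  | succ a ih =>
    intro m hm
    have : X 0 ^ (a + 1) * P m = X 1 * (X 0 ^ a * P (m + 1)) - X 0 ^ a * P (m + 2) := by
      rw [P]; ring
    rw [this]
    exact sub_mem (Ideal.mul_mem_left _ _ (ih _ (by omega))) (ih _ (by omega))

lemma mono_eq (e : Fin 2 →₀ ℕ) (c : ℝ) : monomial e c = c • (X 0 ^ e 0 * X 1 ^ e 1) := by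
  rw [monomial_eq, Finsupp.prod_fintype _ _ (by simp), Fin.prod_univ_two, smul_eq_C_mul]

lemma span_sP : Submodule.span ℝ (Set.range fun am : ℕ × ℕ => X 0 ^ am.1 * P am.2)
    = (⊤ : Submodule ℝ (MvPolynomial (Fin 2) ℝ)) := by
  set W := Submodule.span ℝ (Set.range fun am : ℕ × ℕ => X 0 ^ am.1 * P am.2) with hW
  have gen : ∀ a m, X 0 ^ a * P m ∈ W := fun a m => Submodule.subset_span ⟨(a, m), rfl⟩
  have ht : ∀ g ∈ W, X 1 * g ∈ W := by
    intro g hg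
    induction hg using Submodule.span_induction with
    | mem x hx =>
      obtain ⟨⟨a, m⟩, rfl⟩ := hx
      rcases m with _ | m
      · have : X 1 * (X 0 ^ a * P 0) = (2 : ℝ) • (X 0 ^ a * P 1) := by
          rw [P, P, smul_eq_C_mul, map_ofNat]; ring
        simp only [this]
        exact W.smul_mem _ (gen _ _)
      · have : X 1 * (X 0 ^ a * P (m + 1)) = (X 0 ^ a * P (m + 2)) + (X 0 ^ (a + 1) * P m) := by
          rw [P]; ring
        simp only [this]
        exact W.add_mem (gen _ _) (gen _ _)
    | zero => simp
    | add x y _ _ hx hy => rw [mul_add]; exact W.add_mem hx hy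
    | smul c x _ hx => rw [mul_smul_comm]; exact W.smul_mem _ hx
  have hm : ∀ a b, X 0 ^ a * X 1 ^ b ∈ W := by
    intro a b
    induction b with
    | zero =>
      have : X 0 ^ a * X 1 ^ 0 = (1 / 2 : ℝ) • (X 0 ^ a * P 0) := by
        rw [P, ← map_ofNat C 2, smul_eq_C_mul, mul_left_comm, ← C_mul]; norm_num
      rw [this]
      exact W.smul_mem _ (gen _ _)
    | succ b ih =>
      have := ht _ ih
      rwa [show X 1 * (X 0 ^ a * X 1 ^ b) = (X 0 ^ a * X 1 ^ (b + 1) : MvPolynomial (Fin 2) ℝ) by ring]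
        at this
  rw [eq_top_iff]
  intro g _
  induction g using MvPolynomial.induction_on' with
  | monomial e c => rw [mono_eq]; exact W.smul_mem _ (hm _ _)
  | add p q hp hq => exact W.add_mem (hp trivial) (hq trivial)

lemma span_quot (n : ℕ) : Submodule.span ℝ (Set.range fun am : {am : ℕ × ℕ // am.1 + am.2 ≤ n} =>
    Ideal.Quotient.mk (Ideal.span {P (n + 1), P (n + 2)}) (X 0 ^ am.1.1 * P am.1.2)) = ⊤ := by
  set W := Submodule.span ℝ (Set.range fun am : {am : ℕ × ℕ // am.1 + am.2 ≤ n} =>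
    Ideal.Quotient.mk (Ideal.span {P (n + 1), P (n + 2)}) (X 0 ^ am.1.1 * P am.1.2)) with hW
  rw [eq_top_iff]
  intro q _
  obtain ⟨g, rfl⟩ := Ideal.Quotient.mk_surjective q
  have hg : g ∈ Submodule.span ℝ (Set.range fun am : ℕ × ℕ => X 0 ^ am.1 * P am.2) := by
    rw [span_sP]; trivial
  have : Submodule.span ℝ (Set.range fun am : ℕ × ℕ => X 0 ^ am.1 * P am.2) ≤
      W.comap (Ideal.Quotient.mkₐ ℝ (Ideal.span {P (n + 1), P (n + 2)})).toLinearMap := by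
    rw [Submodule.span_le]
    rintro _ ⟨⟨a, m⟩, rfl⟩
    change Ideal.Quotient.mk _ _ ∈ W
    rcases le_or_gt (a + m) n with h | h
    · exact Submodule.subset_span ⟨⟨(a, m), h⟩, rfl⟩
    · rw [Ideal.Quotient.eq_zero_iff_mem.2 (sP_mem n a m h)]
      exact W.zero_mem
  exact this hg

/-! Independence -/

/-- specialization `s = Z ^ 2`, `t = 2 cos θ Z` -/
noncomputable def Psi (θ : ℝ) : MvPolynomial (Fin 2) ℝ →ₐ[ℝ] Polynomial ℝ :=
  aeval ![Polynomial.X ^ 2, Polynomial.C (2 * Real.cos θ) * Polynomial.X]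

lemma Psi_mono (θ : ℝ) (a b : ℕ) : Psi θ (X 0 ^ a * X 1 ^ b) =
    Polynomial.C ((2 * Real.cos θ) ^ b) * Polynomial.X ^ (2 * a + b) := by
  simp only [Psi, map_mul, map_pow, aeval_X, Matrix.cons_val_zero, Matrix.cons_val_one]
  ring

lemma Psi_P (θ : ℝ) (k : ℕ) : Psi θ (P k) =
    Polynomial.C (2 * Real.cos (k * θ)) * Polynomial.X ^ k := by
  induction k using Nat.strong_induction_on with
  | _ k ih =>
    match k, ih with
    | 0, _ =>
      rw [P, map_ofNat]
      simp only [Nat.cast_zero, zero_mul, Real.cos_zero, mul_one, pow_zero]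
      exact (map_ofNat Polynomial.C 2).symm
    | 1, _ => rw [P]; simp [Psi]
    | k + 2, ih =>
      rw [P, map_sub, map_mul, map_mul, ih k (by omega), ih (k + 1) (by omega)]
      have h0 : Psi θ (X 0) = Polynomial.X ^ 2 := by simp [Psi]
      have h1 : Psi θ (X 1) = Polynomial.C (2 * Real.cos θ) * Polynomial.X := by simp [Psi]
      have h2 : 2 * Real.cos ((k + 2 : ℕ) * θ) =
          2 * Real.cos θ * (2 * Real.cos ((k + 1 : ℕ) * θ)) - 2 * Real.cos (k * θ) := by
        have e1 : ((k + 2 : ℕ) : ℝ) * θ = (k + 1 : ℕ) * θ + θ := by push_cast; ring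
        have e2 : (k : ℝ) * θ = (k + 1 : ℕ) * θ - θ := by push_cast; ring
        rw [e1, e2, Real.cos_add, Real.cos_sub]; ring
      rw [h0, h1, h2, Polynomial.C_sub, Polynomial.C_mul (a := 2 * Real.cos θ)]
      ring

lemma Psi_cont (g : MvPolynomial (Fin 2) ℝ) (N : ℕ) : Continuous fun θ => (Psi θ g).coeff N := by
  induction g using MvPolynomial.induction_on' with
  | monomial e c =>
    simp only [mono_eq, map_smul, Psi_mono, Polynomial.coeff_smul, Polynomial.coeff_C_mul]
    fun_prop
  | add p q hp hq =>
    simp only [map_add, Polynomial.coeff_add]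
    exact hp.add hq

/-- the functional -/
noncomputable def L (N : ℕ) (g : MvPolynomial (Fin 2) ℝ) : ℝ :=
  ∫ θ in (0 : ℝ)..Real.pi, (Psi θ g).coeff N

lemma L_add (N : ℕ) (g h : MvPolynomial (Fin 2) ℝ) : L N (g + h) = L N g + L N h := by
  simp only [L, map_add, Polynomial.coeff_add]
  exact intervalIntegral.integral_add ((Psi_cont g N).intervalIntegrable _ _)
    ((Psi_cont h N).intervalIntegrable _ _)

lemma int_zero (b : ℕ) : ∀ m : ℕ, b < m →
    ∫ θ in (0 : ℝ)..Real.pi, Real.cos (m * θ) * (2 * Real.cos θ) ^ b = 0 := by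
  induction b with
  | zero =>
    intro m hm
    have hm' : (m : ℝ) ≠ 0 := by positivity
    simp only [pow_zero, mul_one]
    rw [intervalIntegral.integral_comp_mul_left (fun x => Real.cos x) hm']
    simp
  | succ b ih =>
    intro m hm
    obtain ⟨j, rfl⟩ : ∃ j, m = j + 1 := ⟨m - 1, by omega⟩
    have : ∀ θ : ℝ, Real.cos ((j + 1 : ℕ) * θ) * (2 * Real.cos θ) ^ (b + 1) =
        Real.cos ((j + 2 : ℕ) * θ) * (2 * Real.cos θ) ^ b
        + Real.cos (j * θ) * (2 * Real.cos θ) ^ b := by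
      intro θ
      have e1 : ((j + 2 : ℕ) : ℝ) * θ = (j + 1 : ℕ) * θ + θ := by push_cast; ring
      have e2 : (j : ℝ) * θ = (j + 1 : ℕ) * θ - θ := by push_cast; ring
      rw [e1, e2, Real.cos_add, Real.cos_sub]; ring
    simp only [this]
    rw [intervalIntegral.integral_add, ih _ (by omega), ih _ (by omega), add_zero]
    all_goals exact Continuous.intervalIntegrable (by fun_prop) _ _

lemma L_mul_P (n m : ℕ) (hm : n + 1 ≤ m) (a : MvPolynomial (Fin 2) ℝ) :
    L (2 * n) (a * P m) = 0 := by
  induction a using MvPolynomial.induction_on' with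
  | monomial e c =>
    simp only [L, mono_eq, map_smul, map_mul, smul_mul_assoc]
    simp only [← map_mul, Psi_mono, Psi_P]
    have : ∀ θ, (c • (Polynomial.C ((2 * Real.cos θ) ^ e 1) * Polynomial.X ^ (2 * e 0 + e 1) *
        (Polynomial.C (2 * Real.cos (m * θ)) * Polynomial.X ^ m))).coeff (2 * n) =
        (if 2 * n = 2 * e 0 + e 1 + m then 2 * c else 0) *
          (Real.cos (m * θ) * (2 * Real.cos θ) ^ e 1) := by
      intro θ
      rw [show Polynomial.C ((2 * Real.cos θ) ^ e 1) * Polynomial.X ^ (2 * e 0 + e 1) *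
        (Polynomial.C (2 * Real.cos (m * θ)) * Polynomial.X ^ m) =
        Polynomial.C ((2 * Real.cos θ) ^ e 1 * (2 * Real.cos (m * θ))) *
          Polynomial.X ^ (2 * e 0 + e 1 + m) by
            rw [Polynomial.C_mul (a := (2 * Real.cos θ) ^ e 1)]; ring,
        Polynomial.coeff_smul, Polynomial.coeff_C_mul_X_pow]
      split_ifs
      · rw [smul_eq_mul]; ring
      · simp
    simp only [this]
    rw [intervalIntegral.integral_const_mul]
    split_ifs with h
    · rw [int_zero _ _ (by omega), mul_zero]
    · simp
  | add p q hp hq => rw [add_mul, L_add, hp, hq, add_zero]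

lemma L_ideal (n : ℕ) (g : MvPolynomial (Fin 2) ℝ) (hg : g ∈ Ideal.span {P (n + 1), P (n + 2)}) :
    L (2 * n) g = 0 := by
  obtain ⟨a, b, rfl⟩ := Ideal.mem_span_pair.1 hg
  rw [L_add, L_mul_P n _ le_rfl, L_mul_P n _ (by omega), add_zero]

lemma poly_zero (Q : Polynomial ℝ)
    (h : ∫ θ in (0 : ℝ)..Real.pi, (Q.eval (2 * Real.cos θ)) ^ 2 = 0) : Q = 0 := by
  by_contra hQ
  have hc : Continuous fun θ : ℝ => (Q.eval (2 * Real.cos θ)) ^ 2 := by fun_prop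
  have hz : ∀ θ ∈ Set.Icc (0 : ℝ) Real.pi, Q.eval (2 * Real.cos θ) = 0 := by
    intro θ hθ
    by_contra hne
    have : 0 < ∫ θ in (0 : ℝ)..Real.pi, (Q.eval (2 * Real.cos θ)) ^ 2 :=
      intervalIntegral.integral_pos Real.pi_pos hc.continuousOn (fun x _ => sq_nonneg _)
        ⟨θ, hθ, by positivity⟩
    exact this.ne' h
  apply hQ
  apply Polynomial.eq_zero_of_infinite_isRoot
  refine Set.Infinite.mono (s := Set.Icc (-2 : ℝ) 2) ?_ (Set.Icc_infinite (by norm_num))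
  intro x hx
  have := hz (Real.arccos (x / 2)) ⟨Real.arccos_nonneg _, Real.arccos_le_pi _⟩
  rw [Real.cos_arccos (by linarith [hx.1]) (by linarith [hx.2])] at this
  simpa [mul_div_cancel₀] using this

/-- index type -/
abbrev Idx (n : ℕ) := {kp : ℕ × ℕ // kp.1 ≤ 2 * n ∧ 2 * kp.2 ≤ min kp.1 (2 * n - kp.1)}

lemma indep (n : ℕ) : LinearIndependent ℝ (fun kp : Idx n =>
    Ideal.Quotient.mk (Ideal.span {P (n + 1), P (n + 2)})
      (X 0 ^ kp.1.2 * X 1 ^ (kp.1.1 - 2 * kp.1.2))) := by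
  classical
  rw [linearIndependent_iff']
  intro S c hS i₀ hi₀
  set G : MvPolynomial (Fin 2) ℝ := ∑ i ∈ S, c i • (X 0 ^ i.1.2 * X 1 ^ (i.1.1 - 2 * i.1.2)) with hG
  have hGI : G ∈ Ideal.span {P (n + 1), P (n + 2)} := by
    rw [← Ideal.Quotient.eq_zero_iff_mem, ← hS, hG, map_sum]
    rfl
  set k := i₀.1.1 with hk
  set S' := S.filter (fun i => i.1.1 = k) with hS'
  set H : MvPolynomial (Fin 2) ℝ :=
    ∑ j ∈ S', c j • (X 0 ^ j.1.2 * X 1 ^ (2 * n - k - 2 * j.1.2)) with hH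
  set Q : Polynomial ℝ := ∑ j ∈ S', Polynomial.C (c j) * Polynomial.X ^ (n - 2 * j.1.2) with hQ
  have hL := L_ideal n (G * H) (Ideal.mul_mem_right _ _ hGI)
  have hmain : ∀ θ, (Psi θ (G * H)).coeff (2 * n) = (Q.eval (2 * Real.cos θ)) ^ 2 := by
    intro θ
    rw [hG, hH, hQ, sq, Polynomial.eval_finset_sum, Finset.sum_mul_sum, Finset.sum_mul_sum,
      map_sum, Polynomial.finset_sum_coeff, hS', Finset.sum_filter, ← hS']
    refine Finset.sum_congr rfl fun i _ => ?_
    rw [map_sum, Polynomial.finset_sum_coeff]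
    have hi2 := i.2
    have key : ∀ j ∈ S', (Psi θ (c i • (X 0 ^ i.1.2 * X 1 ^ (i.1.1 - 2 * i.1.2)) *
        c j • (X 0 ^ j.1.2 * X 1 ^ (2 * n - k - 2 * j.1.2)))).coeff (2 * n) =
        if i.1.1 = k then
          (Polynomial.C (c i) * Polynomial.X ^ (n - 2 * i.1.2)).eval (2 * Real.cos θ) *
          (Polynomial.C (c j) * Polynomial.X ^ (n - 2 * j.1.2)).eval (2 * Real.cos θ) else 0 := by
      intro j hj
      have hjk : j.1.1 = k := (Finset.mem_filter.1 hj).2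
      have hj2 := j.2
      rw [smul_mul_smul_comm, map_smul, map_mul, Psi_mono, Psi_mono,
        show ∀ (x y : ℝ) (p q : ℕ), Polynomial.C x * Polynomial.X ^ p *
          (Polynomial.C y * Polynomial.X ^ q) = Polynomial.C (x * y) * Polynomial.X ^ (p + q) from
          fun x y p q => by rw [Polynomial.C_mul]; ring,
        Polynomial.coeff_smul, Polynomial.coeff_C_mul_X_pow, ← pow_add]
      by_cases h : i.1.1 = k
      · rw [if_pos h, if_pos (by omega)]
        simp only [Polynomial.eval_mul, Polynomial.eval_C, Polynomial.eval_pow, Polynomial.eval_X]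
        rw [show i.1.1 - 2 * i.1.2 + (2 * n - k - 2 * j.1.2) =
          (n - 2 * i.1.2) + (n - 2 * j.1.2) by omega, pow_add, smul_eq_mul]
        ring
      · rw [if_neg h, if_neg (by omega), smul_zero]
    rw [Finset.sum_congr rfl key]
    split_ifs <;> simp
  have hQ0 : Q = 0 := by
    apply poly_zero
    rw [L] at hL
    simpa only [hmain] using hL
  have hco : Q.coeff (n - 2 * i₀.1.2) = c i₀ := by
    rw [hQ, Polynomial.finset_sum_coeff, Finset.sum_eq_single i₀]
    · simp
    · intro j hj hne
      have hjk : j.1.1 = k := (Finset.mem_filter.1 hj).2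
      rw [Polynomial.coeff_C_mul_X_pow, if_neg]
      intro h
      apply hne
      have hj2 := j.2
      have hi2 := i₀.2
      apply Subtype.ext
      apply Prod.ext
      · exact hjk
      · omega
    · intro h
      exact absurd (show i₀ ∈ S' from Finset.mem_filter.2 ⟨hi₀, hk.symm⟩) h
  rw [← hco, hQ0, Polynomial.coeff_zero]

instance (n : ℕ) : Finite (Idx n) := by
  have : Set.Finite {kp : ℕ × ℕ | kp.1 ≤ 2 * n ∧ 2 * kp.2 ≤ min kp.1 (2 * n - kp.1)} := by
    refine Set.Finite.subset ((Set.finite_Iic (2 * n)).prod (Set.finite_Iic (2 * n))) ?_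
    rintro ⟨k, p⟩ ⟨h1, h2⟩
    simp only [Set.mem_prod, Set.mem_Iic]
    simp only at h1 h2
    omega
  exact this

/-- injection of the triangle into the index type -/
def inj (n : ℕ) (am : {am : ℕ × ℕ // am.1 + am.2 ≤ n}) : Idx n :=
  ⟨((if am.1.1 % 2 = 0 then am.1.2 else n - 2 * (am.1.1 / 2) + 1 + am.1.2) + 2 * (am.1.1 / 2),
    am.1.1 / 2), by
      have := am.2
      split_ifs <;> simp only <;> omega⟩

lemma inj_injective (n : ℕ) : Function.Injective (inj n) := by
  rintro ⟨⟨a, m⟩, h⟩ ⟨⟨a', m'⟩, h'⟩ he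
  simp only [inj, Subtype.mk.injEq, Prod.mk.injEq] at he h h' ⊢
  obtain ⟨h1, h2⟩ := he
  split_ifs at h1 <;> omega

theorem stmt16 (n : ℕ) (hn : 1 ≤ n) :
    LinearIndependent ℝ
        (fun kp : {kp : ℕ × ℕ // kp.1 ≤ 2 * n ∧ 2 * kp.2 ≤ min kp.1 (2 * n - kp.1)} =>
          Ideal.Quotient.mk (Ideal.span {f (n + 1), f (n + 2)})
            (X 0 ^ kp.1.2 * X 1 ^ (kp.1.1 - 2 * kp.1.2)))
      ∧ Submodule.span ℝ
          (Set.range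
            (fun kp : {kp : ℕ × ℕ // kp.1 ≤ 2 * n ∧ 2 * kp.2 ≤ min kp.1 (2 * n - kp.1)} =>
              Ideal.Quotient.mk (Ideal.span {f (n + 1), f (n + 2)})
                (X 0 ^ kp.1.2 * X 1 ^ (kp.1.1 - 2 * kp.1.2)))) = ⊤ := by
  rw [span_eq]
  have hli := indep n
  refine ⟨hli, ?_⟩
  haveI : Finite {am : ℕ × ℕ // am.1 + am.2 ≤ n} := Finite.of_injective _ (inj_injective n)
  haveI := Fintype.ofFinite {am : ℕ × ℕ // am.1 + am.2 ≤ n}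
  haveI := Fintype.ofFinite (Idx n)
  have hspan := span_quot n
  haveI : FiniteDimensional ℝ (MvPolynomial (Fin 2) ℝ ⧸ Ideal.span {P (n + 1), P (n + 2)}) :=
    ⟨⟨(Set.finite_range _).toFinset, by rw [Set.Finite.coe_toFinset]; exact hspan⟩⟩
  have h1 := finrank_range_le_card (R := ℝ) (fun am : {am : ℕ × ℕ // am.1 + am.2 ≤ n} =>
    Ideal.Quotient.mk (Ideal.span {P (n + 1), P (n + 2)}) (X 0 ^ am.1.1 * P am.1.2))
  rw [Set.finrank, hspan, finrank_top] at h1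
  have h2 := Fintype.card_le_of_injective _ (inj_injective n)
  have h3 := hli.fintype_card_le_finrank
  exact hli.span_eq_top_of_card_eq_finrank' (le_antisymm h3 (h1.trans h2))
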